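/- For every real number n ≥ 0, √(ln(eⁿ + 1)) − √(ln 2) ≤ √n; that is, the expected number of links added with the probability function of equation (3) does not exceed √n. -/

import Mathlib

open Real

theorem sqrt_expected_links_le (n : ℝ) (hn : 0 ≤ n) :
    Real.sqrt (Real.log (Real.exp n + 1)) - Real.sqrt (Real.log 2) ≤ Real.sqrt n := by
  have h2 : 0 ≤ Real.log 2 := Real.log_nonneg (by norm_num)
  have h1 : Real.log (Real.exp n + 1) ≤ n + Real.log 2 := by
    have h : Real.log (Real.exp n + 1) ≤ Real.log (Real.exp n * 2) := by
      apply Real.log_le_log (by positivity)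
      linarith [Real.one_le_exp hn]
    rwa [Real.log_mul (Real.exp_pos n).ne' (by norm_num), Real.log_exp] at h
  rw [sub_le_iff_le_add]
  apply Real.sqrt_le_iff.mpr
  refine ⟨by positivity, ?_⟩
  nlinarith [Real.sq_sqrt hn, Real.sq_sqrt h2,
    mul_nonneg (Real.sqrt_nonneg n) (Real.sqrt_nonneg (Real.log 2))]
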